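/- (Theorem 2, part 2: tightness.) Let 0 < β_L ≤ β_U < 1 and set γ* = 1/(β_L + β_U). For every ε > 0 there exist a parallel routing problem G with affine latencies ℓ_e(y) = a_e·y + b_e (a_e, b_e ≥ 0) in which every edge carries strictly positive flow in every Nash flow of (G, β, 0), a sensitivity distribution β with values in [β_L, β_U], and a Nash flow f of (G, β, γ*) such that L(f) / L*(G) > (4/3)·(1 − (β_L/β_U) / (1 + β_L/β_U)²) − ε. Hence the supremum of L^{nf}(G, β, γ*)/L*(G) over this class equals (4/3)·(1 − (β_L/β_U)/(1 + β_L/β_U)²). -/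

import Mathlib

open MeasureTheory

/-- A nonatomic routing problem: finite edge set, finite commodity set, traffic
rates, finite nonempty path sets, and nondecreasing convex continuously
differentiable nonnegative latency functions. -/
structure RoutingProblem where
  E : Type
  instFintypeE : Fintype E
  instDecEqE : DecidableEq E
  C : Type
  instFintypeC : Fintype C
  r : C → ℝ
  r_pos : ∀ c, 0 < r c
  paths : C → Finset (Finset E)
  paths_nonempty : ∀ c, (paths c).Nonempty
  lat : E → ℝ → ℝ
  lat_nonneg : ∀ e y, 0 ≤ y → 0 ≤ lat e y
  lat_mono : ∀ e, MonotoneOn (lat e) (Set.Ici 0)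
  lat_convex : ∀ e, ConvexOn ℝ (Set.Ici 0) (lat e)
  lat_smooth : ∀ e, ContDiffOn ℝ 1 (lat e) (Set.Ici 0)

attribute [instance] RoutingProblem.instFintypeE RoutingProblem.instDecEqE
  RoutingProblem.instFintypeC

namespace RoutingProblem

variable (G : RoutingProblem)

/-- `σ` is a valid assignment of users `[0, r c]` to paths of their commodity,
measurable in the sense that each preimage of a path is measurable. -/
def IsAssignment (σ : G.C → ℝ → Finset G.E) : Prop :=
  (∀ c x, x ∈ Set.Icc 0 (G.r c) → σ c x ∈ G.paths c) ∧
  (∀ c (p : Finset G.E), MeasurableSet {x : ℝ | σ c x = p})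

/-- The edge flow induced by an assignment. -/
noncomputable def edgeFlow (σ : G.C → ℝ → Finset G.E) (e : G.E) : ℝ :=
  ∑ c, (volume {x : ℝ | x ∈ Set.Icc 0 (G.r c) ∧ e ∈ σ c x}).toReal

/-- The path flow induced by an assignment. -/
noncomputable def pathFlow (σ : G.C → ℝ → Finset G.E) (p : Finset G.E) : ℝ :=
  ∑ c, (volume {x : ℝ | x ∈ Set.Icc 0 (G.r c) ∧ σ c x = p}).toReal

/-- Total latency of an edge-flow vector. -/
noncomputable def totalLatency (f : G.E → ℝ) : ℝ :=
  ∑ e, f e * G.lat e (f e)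

/-- `β` is a sensitivity distribution: for each commodity a nondecreasing
measurable function into `[0,1]`. -/
def IsSensitivity (β : G.C → ℝ → ℝ) : Prop :=
  ∀ c, MonotoneOn (β c) (Set.Icc 0 (G.r c)) ∧ Measurable (β c) ∧
    ∀ x ∈ Set.Icc 0 (G.r c), β c x ∈ Set.Icc (0:ℝ) 1

/-- Slowdown-sensitivity cost of path `p` under edge flow `f` for user `x` of
commodity `c`, given signal `γ`. -/
noncomputable def cost (β : G.C → ℝ → ℝ) (γ : ℝ) (c : G.C) (x : ℝ)
    (p : Finset G.E) (f : G.E → ℝ) : ℝ :=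
  ∑ e ∈ p, (G.lat e (f e) - γ * β c x * G.lat e 0)

/-- Nash flow for a general family of user cost functions `K c x p f`. -/
def IsNashFor (K : G.C → ℝ → Finset G.E → (G.E → ℝ) → ℝ)
    (σ : G.C → ℝ → Finset G.E) : Prop :=
  G.IsAssignment σ ∧
  ∀ c, ∀ᵐ x ∂(volume.restrict (Set.Icc 0 (G.r c))),
    ∀ p ∈ G.paths c, K c x (σ c x) (G.edgeFlow σ) ≤ K c x p (G.edgeFlow σ)

/-- Nash flow of the slowdown-sensitivity game `(G, β, γ)`. -/
def IsNashFlow (β : G.C → ℝ → ℝ) (γ : ℝ) (σ : G.C → ℝ → Finset G.E) : Prop :=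
  G.IsNashFor (G.cost β γ) σ

/-- All latency functions are polynomials `a_e y^d + b_e` with `a_e, b_e ≥ 0`. -/
def IsPolyDeg (d : ℕ) : Prop :=
  ∀ e, ∃ a b : ℝ, 0 ≤ a ∧ 0 ≤ b ∧ ∀ y : ℝ, G.lat e y = a * y ^ d + b

/-- Parallel network: each path is a single edge and distinct paths are disjoint. -/
def IsParallel : Prop :=
  (∀ c, ∀ p ∈ G.paths c, p.card = 1) ∧
  (∀ c c', ∀ p ∈ G.paths c, ∀ p' ∈ G.paths c', p ≠ p' → Disjoint p p')

/-- A feasible (fractional) path-flow vector. -/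
def IsFeasible (g : G.C → Finset G.E → ℝ) : Prop :=
  (∀ c p, 0 ≤ g c p) ∧ (∀ c p, p ∉ G.paths c → g c p = 0) ∧
  (∀ c, ∑ p ∈ G.paths c, g c p = G.r c)

/-- Edge flow induced by a fractional path-flow vector. -/
noncomputable def flowOf (g : G.C → Finset G.E → ℝ) (e : G.E) : ℝ :=
  ∑ c, ∑ p ∈ G.paths c, if e ∈ p then g c p else 0

/-- Minimum total latency over feasible flows. -/
noncomputable def optLatency : ℝ :=
  sInf {L : ℝ | ∃ g, G.IsFeasible g ∧ L = G.totalLatency (G.flowOf g)}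

/-- The Rosenthal-type potential of the slowdown-sensitivity game. -/
noncomputable def potential (β : G.C → ℝ → ℝ) (γ : ℝ)
    (σ : G.C → ℝ → Finset G.E) : ℝ :=
  (∑ e, ∫ t in (0:ℝ)..(G.edgeFlow σ e), G.lat e t) -
    γ * ∑ c, ∫ x in Set.Icc (0:ℝ) (G.r c), β c x * ∑ e ∈ σ c x, G.lat e 0

end RoutingProblem

/-- Pigou-type network: edge `true` has latency `y`, edge `false` latency `1`. -/
@[reducible] noncomputable def pigou (d : ℝ) (hd : 0 < d) : RoutingProblem where
  E := Bool
  instFintypeE := inferInstance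
  instDecEqE := inferInstance
  C := Unit
  instFintypeC := inferInstance
  r := fun _ => 1 + d
  r_pos := fun _ => by linarith
  paths := fun _ => {{true}, {false}}
  paths_nonempty := fun _ => ⟨{true}, by simp⟩
  lat := fun e y => if e = true then y else 1
  lat_nonneg := by
    intro e y hy
    cases e <;> simp [hy]
  lat_mono := by
    intro e x hx y hy hxy
    cases e <;> simp [hxy]
  lat_convex := by
    intro e
    cases e
    · simpa using convexOn_const (1:ℝ) (convex_Ici (0:ℝ))
    · exact convexOn_id (convex_Ici (0:ℝ))
  lat_smooth := by
    intro e
    cases e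
    · simpa using contDiffOn_const
    · exact contDiffOn_id

/-- The flow of an edge used by almost everybody is the full rate. -/
theorem pigou_flow_full (d : ℝ) (hd : 0 < d) (σ : Unit → ℝ → Finset Bool) (e : Bool)
    (h : ∀ᵐ x ∂(volume.restrict (Set.Icc (0:ℝ) (1 + d))), e ∈ σ () x) :
    (pigou d hd).edgeFlow σ e = 1 + d := by
  change ∑ c : Unit, (volume {x : ℝ | x ∈ Set.Icc 0 (1 + d) ∧ e ∈ σ c x}).toReal = 1 + d
  rw [Fintype.sum_unique]
  have h2 : ∀ᵐ x : ℝ, x ∈ Set.Icc (0:ℝ) (1 + d) → e ∈ σ () x :=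
    (ae_restrict_iff' measurableSet_Icc).1 h
  have h3 : volume {x : ℝ | x ∈ Set.Icc 0 (1 + d) ∧ e ∈ σ () x} =
      volume (Set.Icc (0:ℝ) (1 + d)) := by
    apply measure_congr
    filter_upwards [h2] with x hx
    apply propext
    constructor
    · intro h
      exact h.1
    · intro h
      exact ⟨h, hx h⟩
  change (volume {x : ℝ | x ∈ Set.Icc 0 (1 + d) ∧ e ∈ σ () x}).toReal = 1 + d
  rw [h3, Real.volume_Icc, ENNReal.toReal_ofReal (by linarith)]
  ring

theorem pigou_flow_zero (d : ℝ) (hd : 0 < d) (σ : Unit → ℝ → Finset Bool) (e : Bool)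
    (h : (pigou d hd).edgeFlow σ e = 0) :
    ∀ᵐ x ∂(volume.restrict (Set.Icc (0:ℝ) (1 + d))), e ∉ σ () x := by
  change ∑ c : Unit, (volume {x : ℝ | x ∈ Set.Icc 0 (1 + d) ∧ e ∈ σ c x}).toReal = 0 at h
  rw [Fintype.sum_unique] at h
  change (volume {x : ℝ | x ∈ Set.Icc 0 (1 + d) ∧ e ∈ σ () x}).toReal = 0 at h
  have hfin : volume {x : ℝ | x ∈ Set.Icc 0 (1 + d) ∧ e ∈ σ () x} ≠ ⊤ := by
    refine ne_top_of_le_ne_top ?_ (measure_mono (t := Set.Icc (0:ℝ) (1 + d)) fun x hx => hx.1)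
    simp
  have h0 : volume {x : ℝ | x ∈ Set.Icc 0 (1 + d) ∧ e ∈ σ () x} = 0 := by
    rcases (ENNReal.toReal_eq_zero_iff _).1 h with h | h
    · exact h
    · exact absurd h hfin
  rw [ae_restrict_iff' measurableSet_Icc]
  have := measure_eq_zero_iff_ae_notMem.1 h0
  filter_upwards [this] with x hx hx1 hx2
  exact hx ⟨hx1, hx2⟩

theorem pigou_pos (d : ℝ) (hd : 0 < d) (β : Unit → ℝ → ℝ) (σ : Unit → ℝ → Finset Bool)
    (hN : (pigou d hd).IsNashFlow β 0 σ) (e : Bool) : 0 < (pigou d hd).edgeFlow σ e := by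
  obtain ⟨⟨hA, -⟩, hN⟩ := hN
  have hA' : ∀ x ∈ Set.Icc (0:ℝ) (1 + d), σ () x = {true} ∨ σ () x = {false} := by
    intro x hx
    have := hA () x hx
    change σ () x ∈ ({{true}, {false}} : Finset (Finset Bool)) at this
    simpa using this
  have hmem : ∀ᵐ x ∂(volume.restrict (Set.Icc (0:ℝ) (1 + d))),
      σ () x = {true} ∨ σ () x = {false} :=
    (ae_restrict_iff' measurableSet_Icc).2 (Filter.Eventually.of_forall hA')
  have hN' := hN ()
  change ∀ᵐ x ∂(volume.restrict (Set.Icc (0:ℝ) (1 + d))),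
    ∀ p ∈ ({{true}, {false}} : Finset (Finset Bool)),
      ∑ e ∈ σ () x, ((if e = true then (pigou d hd).edgeFlow σ e else 1)
        - 0 * β () x * (if e = true then 0 else 1)) ≤
      ∑ e ∈ p, ((if e = true then (pigou d hd).edgeFlow σ e else 1)
        - 0 * β () x * (if e = true then 0 else 1)) at hN'
  have hnn : 0 ≤ (pigou d hd).edgeFlow σ e :=
    Finset.sum_nonneg fun c _ => ENNReal.toReal_nonneg
  refine lt_of_le_of_ne hnn fun h0 => ?_
  have hz := pigou_flow_zero d hd σ e h0.symm
  cases e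
  · -- nobody on the constant edge
    have hf : (pigou d hd).edgeFlow σ true = 1 + d := by
      apply pigou_flow_full
      filter_upwards [hmem, hz] with x h1 h2
      rcases h1 with h1 | h1 <;> simp_all
    have hF : (pigou d hd).edgeFlow σ false = 1 + d := by
      apply pigou_flow_full
      filter_upwards [hmem, hN'] with x h1 h2
      rcases h1 with h1 | h1
      · have := h2 {false} (by simp)
        rw [h1, Finset.sum_singleton, Finset.sum_singleton, hf] at this
        simp at this
        linarith
      · simp [h1]
    linarith
  · have hF : (pigou d hd).edgeFlow σ true = 1 + d := by
      apply pigou_flow_full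
      filter_upwards [hmem, hN'] with x h1 h2
      rcases h1 with h1 | h1
      · simp [h1]
      · have := h2 {true} (by simp)
        rw [h1, Finset.sum_singleton, Finset.sum_singleton, ← h0] at this
        norm_num at this
    linarith

theorem pigou_total (d : ℝ) (hd : 0 < d) (f : Bool → ℝ) :
    (pigou d hd).totalLatency f = f true * f true + f false := by
  change ∑ e : Bool, f e * (if e = true then f e else 1) = _
  simp

theorem pigou_opt (d : ℝ) (hd : 0 < d) : (pigou d hd).optLatency = 3 / 4 + d := by
  have hne : ({true} : Finset Bool) ≠ {false} := by decide
  have hflow : ∀ (g : Unit → Finset Bool → ℝ) (e : Bool), (pigou d hd).flowOf g e = g () {e} := by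
    intro g e
    change ∑ c : Unit, ∑ p ∈ ({{true}, {false}} : Finset (Finset Bool)),
      (if e ∈ p then g c p else 0) = _
    rw [Fintype.sum_unique, Finset.sum_pair hne]
    cases e <;> simp
  apply IsLeast.csInf_eq
  constructor
  · refine ⟨fun _ p => if p = {true} then 1 / 2 else if p = {false} then 1 / 2 + d else 0,
      ⟨?_, ?_, ?_⟩, ?_⟩
    · intro c p
      dsimp only
      split_ifs <;> linarith
    · intro c p hp
      change p ∉ ({{true}, {false}} : Finset (Finset Bool)) at hp
      simp only [Finset.mem_insert, Finset.mem_singleton, not_or] at hp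
      dsimp only
      rw [if_neg hp.1, if_neg hp.2]
    · intro c
      change ∑ p ∈ ({{true}, {false}} : Finset (Finset Bool)), _ = 1 + d
      rw [Finset.sum_pair hne]
      dsimp only
      rw [if_pos rfl, if_neg hne.symm, if_pos rfl]
      ring
    · rw [pigou_total, hflow, hflow, if_pos rfl, if_neg hne.symm, if_pos rfl]
      ring
  · rintro L ⟨g, ⟨-, -, hg⟩, rfl⟩
    have := hg ()
    change ∑ p ∈ ({{true}, {false}} : Finset (Finset Bool)), g () p = 1 + d at this
    rw [Finset.sum_pair hne] at this
    rw [pigou_total, hflow, hflow]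
    nlinarith [sq_nonneg (g () {true} - 1 / 2)]

theorem pigou_nash (d : ℝ) (hd : 0 < d) (b γ : ℝ) (h1 : 0 ≤ γ * b) (h2 : γ * b ≤ 1) :
    ∃ σ : Unit → ℝ → Finset Bool,
      (pigou d hd).IsNashFlow (fun _ _ => b) γ σ ∧
      (pigou d hd).edgeFlow σ true = 1 - γ * b ∧
      (pigou d hd).edgeFlow σ false = d + γ * b := by
  set t := γ * b with ht
  let σ : Unit → ℝ → Finset Bool := fun _ x => if x ≤ 1 - t then {true} else {false}
  have hft : (pigou d hd).edgeFlow σ true = 1 - t := by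
    change ∑ c : Unit, (volume {x : ℝ | x ∈ Set.Icc 0 (1 + d) ∧
      true ∈ (if x ≤ 1 - t then ({true} : Finset Bool) else {false})}).toReal = _
    rw [Fintype.sum_unique]
    have : {x : ℝ | x ∈ Set.Icc 0 (1 + d) ∧
      true ∈ (if x ≤ 1 - t then ({true} : Finset Bool) else {false})} = Set.Icc 0 (1 - t) := by
      ext x
      simp only [Set.mem_ofPred_eq, Set.mem_Icc]
      by_cases hx : x ≤ 1 - t
      · simp [hx]
        intro _
        linarith
      · simp [hx]
    rw [this, Real.volume_Icc, ENNReal.toReal_ofReal (by linarith)]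
    ring
  have hff : (pigou d hd).edgeFlow σ false = d + t := by
    change ∑ c : Unit, (volume {x : ℝ | x ∈ Set.Icc 0 (1 + d) ∧
      false ∈ (if x ≤ 1 - t then ({true} : Finset Bool) else {false})}).toReal = _
    rw [Fintype.sum_unique]
    have : {x : ℝ | x ∈ Set.Icc 0 (1 + d) ∧
      false ∈ (if x ≤ 1 - t then ({true} : Finset Bool) else {false})}
        = Set.Ioc (1 - t) (1 + d) := by
      ext x
      simp only [Set.mem_ofPred_eq, Set.mem_Icc, Set.mem_Ioc]
      by_cases hx : x ≤ 1 - t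
      · simp [hx]
      · simp [hx]
        intro _
        have hx' := not_le.1 hx
        exact ⟨fun _ => by linarith, fun _ => by linarith⟩
    rw [this, Real.volume_Ioc, ENNReal.toReal_ofReal (by linarith)]
    ring
  have hcost : ∀ (x : ℝ) (e : Bool),
      (pigou d hd).cost (fun _ _ => b) γ () x {e} ((pigou d hd).edgeFlow σ) = 1 - t := by
    intro x e
    change ∑ e ∈ ({e} : Finset Bool), ((if e = true then (pigou d hd).edgeFlow σ e else 1)
        - γ * b * (if e = true then 0 else 1)) = 1 - t
    rw [Finset.sum_singleton]
    cases e
    · simp [ht]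
    · simp [hft]
  refine ⟨σ, ⟨⟨?_, ?_⟩, ?_⟩, hft, hff⟩
  · intro c x _
    change (if x ≤ 1 - t then ({true} : Finset Bool) else {false}) ∈
      ({{true}, {false}} : Finset (Finset Bool))
    split_ifs <;> simp
  · intro c p
    change MeasurableSet {x : ℝ | (if x ≤ 1 - t then ({true} : Finset Bool) else {false}) = p}
    have hm : MeasurableSet {x : ℝ | x ≤ 1 - t} := measurableSet_Iic
    have : {x : ℝ | (if x ≤ 1 - t then ({true} : Finset Bool) else {false}) = p} =
        ({x : ℝ | x ≤ 1 - t} ∩ {_x : ℝ | ({true} : Finset Bool) = p}) ∪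
        ({x : ℝ | x ≤ 1 - t}ᶜ ∩ {_x : ℝ | ({false} : Finset Bool) = p}) := by
      ext x
      by_cases hx : x ≤ 1 - t <;> simp [hx]
    rw [this]
    exact (hm.inter (MeasurableSet.const _)).union (hm.compl.inter (MeasurableSet.const _))
  · intro c
    refine Filter.Eventually.of_forall fun x p hp => ?_
    change p ∈ ({{true}, {false}} : Finset (Finset Bool)) at hp
    have hp' : ∃ e : Bool, p = {e} := by
      simp only [Finset.mem_insert, Finset.mem_singleton] at hp
      rcases hp with hp | hp
      · exact ⟨_, hp⟩
      · exact ⟨_, hp⟩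
    have hs : ∃ e : Bool, σ c x = {e} := by
      by_cases hx : x ≤ 1 - t
      · exact ⟨true, if_pos hx⟩
      · exact ⟨false, if_neg hx⟩
    obtain ⟨e, rfl⟩ := hp'
    obtain ⟨e', he'⟩ := hs
    rw [he']
    exact ((hcost x e').trans (hcost x e).symm).le



/-- Theorem 2, part 2, tightness: the bound
`(4/3)(1 − (β_L/β_U)/(1 + β_L/β_U)²)` on the equilibrium efficiency under the
signal `γ* = 1/(β_L + β_U)` is approached arbitrarily closely. -/
theorem optimal_signal_poa_tight (βL βU : ℝ)
    (h0 : 0 < βL) (hLU : βL ≤ βU) (hU : βU < 1)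
    (ε : ℝ) (hε : 0 < ε) :
    ∃ G : RoutingProblem, G.IsParallel ∧ G.IsPolyDeg 1 ∧
      (∀ β : G.C → ℝ → ℝ, G.IsSensitivity β →
        (∀ c x, x ∈ Set.Icc 0 (G.r c) → β c x ∈ Set.Icc βL βU) →
        ∀ σ : G.C → ℝ → Finset G.E, G.IsNashFlow β 0 σ →
          ∀ e, 0 < G.edgeFlow σ e) ∧
      ∃ β : G.C → ℝ → ℝ, G.IsSensitivity β ∧
        (∀ c x, x ∈ Set.Icc 0 (G.r c) → β c x ∈ Set.Icc βL βU) ∧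
        ∃ σ : G.C → ℝ → Finset G.E, G.IsNashFlow β (1 / (βL + βU)) σ ∧
          4 / 3 * (1 - (βL / βU) / (1 + βL / βU) ^ 2) - ε <
            G.totalLatency (G.edgeFlow σ) / G.optLatency := by
  have hS : 0 < βL + βU := by linarith
  set t := 1 / (βL + βU) * βL with ht
  have ht0 : 0 ≤ t := by positivity
  have ht1 : t ≤ 1 := by
    rw [ht, one_div_mul_eq_div, div_le_one hS]
    linarith
  have hT : (βL / βU) / (1 + βL / βU) ^ 2 = t * (1 - t) := by
    have : 0 < βU := by linarith
    rw [ht]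
    field_simp
    ring
  obtain ⟨σ, hN, hf1, hf2⟩ := pigou_nash ε hε βL (1 / (βL + βU)) ht0 ht1
  refine ⟨pigou ε hε, ⟨?_, ?_⟩, ?_, ?_, fun _ _ => βL, ?_, ?_, σ, hN, ?_⟩
  · intro c p hp
    change p ∈ ({{true}, {false}} : Finset (Finset Bool)) at hp
    simp only [Finset.mem_insert, Finset.mem_singleton] at hp
    rcases hp with rfl | rfl <;> rfl
  · intro c c' p hp p' hp' hne
    change p ∈ ({{true}, {false}} : Finset (Finset Bool)) at hp
    change p' ∈ ({{true}, {false}} : Finset (Finset Bool)) at hp'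
    simp only [Finset.mem_insert, Finset.mem_singleton] at hp hp'
    rcases hp with rfl | rfl <;> rcases hp' with rfl | rfl
    · exact absurd rfl hne
    · exact Finset.disjoint_singleton.2 (by decide)
    · exact Finset.disjoint_singleton.2 (by decide)
    · exact absurd rfl hne
  · intro e
    cases e with
    | false => exact ⟨0, 1, le_rfl, zero_le_one, fun y => by simp [pigou]⟩
    | true => exact ⟨1, 0, zero_le_one, le_rfl, fun y => by simp [pigou]⟩
  · intro β _ _ σ' hσ e
    exact pigou_pos ε hε β σ' hσ e
  · intro c
    exact ⟨monotoneOn_const, measurable_const, fun x _ => ⟨h0.le, by linarith⟩⟩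
  · intro c x _
    exact ⟨le_rfl, hLU⟩
  · rw [pigou_opt, pigou_total, hf1, hf2, hT, lt_div_iff₀ (by linarith)]
    change _ < (1 - t) * (1 - t) + (ε + t)
    nlinarith [mul_pos hε hε, mul_nonneg ht0 (sub_nonneg.2 ht1),
      mul_nonneg hε.le (mul_nonneg ht0 (sub_nonneg.2 ht1))]
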